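/- arXiv:2507.17316 — 2 statements merged into one kernel-verified Lean document; each statement's English description precedes it below -/
import Mathlib

section
/- There exists an absolute constant C > 0 (one may take C = 4·10⁻⁶) such that for every integer K ≥ 2, every δ ∈ (0, 1/2), and every sample size n ≥ (log 2 / 2)·K², the minimax rate satisfies r_n*(δ) ≥ C·K/n. -/
open scoped ENNReal
open MeasureTheory

/-- The probability simplex on `Fin K`. -/
def simplex (K : ℕ) : Set (Fin K → ℝ) :=
  {p | (∀ i, 0 ≤ p i) ∧ ∑ i, p i = 1}

/-- Kullback–Leibler divergence between two vectors on `Fin K`, with the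
conventions `0 · log 0 = 0` and value `∞` if `p i > 0 = q i` for some `i`. -/
noncomputable def klD {K : ℕ} (p q : Fin K → ℝ) : ℝ≥0∞ :=
  if ∀ i, 0 < p i → 0 < q i then ENNReal.ofReal (∑ i, p i * Real.log (p i / q i)) else ⊤

/-- The law of `n` i.i.d. samples from the distribution `p` on `Fin K`. -/
noncomputable def iidMeasure (n K : ℕ) (p : Fin K → ℝ) : Measure (Fin n → Fin K) :=
  ∑ x : Fin n → Fin K, (∏ t, ENNReal.ofReal (p (x t))) • Measure.dirac x

/-- `countTo x t i` is the number of indices `s` among the first `t` samples with `x s = i`. -/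
def countTo {n K : ℕ} (x : Fin n → Fin K) (t : ℕ) (i : Fin K) : ℕ :=
  (Finset.univ.filter (fun s : Fin n => (s : ℕ) < t ∧ x s = i)).card

/-- The worst-case rate of an estimator at confidence level `1 - δ`:
the least `r` such that `sup_{p ∈ Δ^K} P(KL(p‖p̂) > r) ≤ δ` (with value `∞` if no such
`r` exists). -/
noncomputable def worstRate (n K : ℕ) (phat : (Fin n → Fin K) → (Fin K → ℝ)) (δ : ℝ) : ℝ≥0∞ :=
  ⨅ (r : ℝ≥0∞) (_ : (⨆ p : {p : Fin K → ℝ // p ∈ simplex K},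
      iidMeasure n K p.val {x | r < klD p.val (phat x)}) ≤ ENNReal.ofReal δ), r

/-- The minimax rate: the infimum of worst-case rates over all estimators. -/
noncomputable def minimaxRate (n K : ℕ) (δ : ℝ) : ℝ≥0∞ :=
  ⨅ phat : {f : (Fin n → Fin K) → (Fin K → ℝ) // ∀ x, f x ∈ simplex K},
    worstRate n K phat.val δ
/-- An Assouad-type bound with ternary coordinates: if shifting any one coordinate of the parameter
barely changes the law, and for each observation each coordinate is compatible with at most one
value, then under some parameter at least a sixth of the coordinates are incompatible with
probability at least one half. -/
lemma exists_half_le_sum_of_ternary {ι X : Type*} [Fintype ι] [DecidableEq ι] [Nonempty ι]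
    [Fintype X] (P : (ι → Fin 3) → X → ℝ) (hP : ∀ v x, 0 ≤ P v x) (hP1 : ∀ v, ∑ x, P v x = 1)
    (hclose : ∀ v j a, ∑ x, |P (v + Pi.single j a) x - P v x| ≤ 1 / 12)
    (g : ι → Fin 3 → X → Prop) (hg : ∀ j a b x, g j a x → g j b x → a = b) :
    open Classical in
    ∃ v, 1 / 2 ≤ ∑ x, if (∑ j, if g j (v j) x then (1 : ℝ) else 0) ≤ 5 / 6 * Fintype.card ι
      then P v x else 0 := by
  classical
  by_contra! hlt
  set G : (ι → Fin 3) → X → ℝ := fun v x => ∑ j, if g j (v j) x then (1 : ℝ) else 0 with hG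
  have hm : (0 : ℝ) < Fintype.card ι := by exact_mod_cast Fintype.card_pos
  have hGnn : ∀ v x, 0 ≤ G v x := fun v x =>
    Finset.sum_nonneg fun j _ => by split_ifs <;> norm_num
  have hlower : ∀ v, 5 / 12 * (Fintype.card ι : ℝ) < ∑ x, P v x * G v x := by
    intro v
    have h1 : ∑ x, 5 / 6 * (Fintype.card ι : ℝ) *
        (P v x - if G v x ≤ 5 / 6 * Fintype.card ι then P v x else 0) ≤ ∑ x, P v x * G v x := by
      refine Finset.sum_le_sum fun x _ => ?_
      split_ifs with h
      · simpa using mul_nonneg (hP v x) (hGnn v x)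
      · nlinarith [hP v x, not_le.1 h]
    rw [← Finset.mul_sum, Finset.sum_sub_distrib, hP1] at h1
    nlinarith [hlt v]
  have hupper : ∀ j, ∑ v, (∑ x, P v x * if g j (v j) x then (1 : ℝ) else 0)
      ≤ ∑ _v : ι → Fin 3, (5 / 12 : ℝ) := by
    intro j
    have hshift : ∀ a : Fin 3, ∑ v, (∑ x, P v x * if g j (v j) x then (1 : ℝ) else 0)
        = ∑ v : ι → Fin 3, ∑ x, P (v + Pi.single j a) x * if g j (v j + a) x then (1 : ℝ) else 0 := by
      intro a
      refine (Equiv.sum_comp (Equiv.addRight (Pi.single j a : ι → Fin 3)) _).symm.trans ?_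
      simp
    have hpoint : ∀ v : ι → Fin 3, ∑ a : Fin 3, (∑ x, P (v + Pi.single j a) x *
        if g j (v j + a) x then (1 : ℝ) else 0) ≤ 5 / 4 := by
      intro v
      calc _ ≤ ∑ a : Fin 3, ((∑ x, |P (v + Pi.single j a) x - P v x|)
              + ∑ x, P v x * if g j (v j + a) x then (1 : ℝ) else 0) := by
            refine Finset.sum_le_sum fun a _ => ?_
            rw [← Finset.sum_add_distrib]
            refine Finset.sum_le_sum fun x _ => ?_
            have h := le_abs_self (P (v + Pi.single j a) x - P v x)
            split_ifs
            · linarith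
            · simp
        _ ≤ ∑ _a : Fin 3, (1 / 12 : ℝ) + 1 := by
            rw [Finset.sum_add_distrib]
            refine add_le_add (Finset.sum_le_sum fun a _ => hclose v j a) ?_
            rw [Finset.sum_comm]
            refine (Finset.sum_le_sum fun x _ => ?_).trans_eq (hP1 v)
            rw [← Finset.mul_sum]
            refine mul_le_of_le_one_right (hP v x) ?_
            rw [Finset.sum_boole]
            have : (Finset.univ.filter fun a => g j (v j + a) x).card ≤ 1 := by
              refine Finset.card_le_one.2 fun a ha b hb => ?_
              simp only [Finset.mem_filter, Finset.mem_univ, true_and] at ha hb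
              exact add_left_cancel (hg j _ _ x ha hb)
            exact_mod_cast this
        _ = 5 / 4 := by norm_num
    have h3 : 3 * ∑ v, (∑ x, P v x * if g j (v j) x then (1 : ℝ) else 0)
        ≤ ∑ _v : ι → Fin 3, (5 / 4 : ℝ) := by
      calc _ = ∑ a : Fin 3, ∑ v, (∑ x, P v x * if g j (v j) x then (1 : ℝ) else 0) := by simp
        _ = _ := Finset.sum_congr rfl fun a _ => hshift a
        _ = _ := Finset.sum_comm
        _ ≤ _ := Finset.sum_le_sum fun v _ => hpoint v
    simp only [Finset.sum_const, nsmul_eq_mul] at h3 ⊢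
    linarith
  have hswap : ∑ v, ∑ x, P v x * G v x
      = ∑ j, ∑ v, (∑ x, P v x * if g j (v j) x then (1 : ℝ) else 0) := by
    simp only [hG, Finset.mul_sum]
    rw [Finset.sum_comm]
    rw [Finset.sum_comm (s := (Finset.univ : Finset ι))]
    rw [Finset.sum_comm]
    exact Finset.sum_congr rfl fun v _ => Finset.sum_comm
  have h1 := Finset.sum_lt_sum_of_nonempty (s := (Finset.univ : Finset (ι → Fin 3)))
    Finset.univ_nonempty fun v _ => hlower v
  have h2 := Finset.sum_le_sum (s := (Finset.univ : Finset ι)) fun j _ => hupper j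
  rw [← hswap] at h2
  simp only [Finset.sum_const, nsmul_eq_mul, Finset.card_univ] at h1 h2
  nlinarith

/-- The total variation distance between product laws is controlled by the chi-square divergence
of the marginals. -/
lemma sq_sum_abs_prod_sub_prod_le {α : Type*} [Fintype α] (n : ℕ) (p q : α → ℝ)
    (hq : ∀ i, 0 < q i) (hp1 : ∑ i, p i = 1) (hq1 : ∑ i, q i = 1) :
    (∑ x : Fin n → α, |∏ t, p (x t) - ∏ t, q (x t)|) ^ 2
      ≤ (1 + ∑ i, (p i - q i) ^ 2 / q i) ^ n - 1 := by
  have hQ : ∀ x : Fin n → α, 0 < ∏ t, q (x t) := fun x => Finset.prod_pos fun t _ => hq _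
  have hP1 : ∑ x : Fin n → α, ∏ t, p (x t) = 1 := by rw [← Fintype.sum_pow, hp1, one_pow]
  have hQ1 : ∑ x : Fin n → α, ∏ t, q (x t) = 1 := by rw [← Fintype.sum_pow, hq1, one_pow]
  have hmarg : 1 + ∑ i, (p i - q i) ^ 2 / q i = ∑ i, p i ^ 2 / q i := by
    have : ∀ i, (p i - q i) ^ 2 / q i = p i ^ 2 / q i - 2 * p i + q i := fun i => by
      have := (hq i).ne'
      field_simp
      ring
    simp only [this, Finset.sum_add_distrib, Finset.sum_sub_distrib, ← Finset.mul_sum, hp1, hq1]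
    ring
  have hprod : (1 + ∑ i, (p i - q i) ^ 2 / q i) ^ n - 1
      = ∑ x : Fin n → α, (∏ t, p (x t) - ∏ t, q (x t)) ^ 2 / ∏ t, q (x t) := by
    have : ∀ x : Fin n → α, (∏ t, p (x t) - ∏ t, q (x t)) ^ 2 / ∏ t, q (x t)
        = ∏ t, (p (x t) ^ 2 / q (x t)) - 2 * ∏ t, p (x t) + ∏ t, q (x t) := fun x => by
      have := (hQ x).ne'
      rw [Finset.prod_div_distrib, Finset.prod_pow]
      field_simp
      ring
    simp only [this, Finset.sum_add_distrib, Finset.sum_sub_distrib, ← Finset.mul_sum, hP1, hQ1]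
    rw [hmarg, Fintype.sum_pow]
    ring
  have := Finset.sq_sum_div_le_sum_sq_div Finset.univ
    (fun x : Fin n → α => |∏ t, p (x t) - ∏ t, q (x t)|) fun x _ => hQ x
  simpa only [hprod, hQ1, div_one, sq_abs] using this

/-- The Kullback–Leibler divergence dominates the squared Hellinger distance. -/
lemma sum_sq_sqrt_sub_sqrt_le_klD {K : ℕ} {p q : Fin K → ℝ} (hp : p ∈ simplex K)
    (hq : q ∈ simplex K) :
    ENNReal.ofReal (∑ i, (√(p i) - √(q i)) ^ 2) ≤ klD p q := by
  unfold klD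
  split_ifs with h
  · refine ENNReal.ofReal_le_ofReal ?_
    have hterm : ∀ i, (√(p i) - √(q i)) ^ 2 ≤ p i * Real.log (p i / q i) - p i + q i := by
      intro i
      have hsp := Real.sq_sqrt (hp.1 i)
      have hsq := Real.sq_sqrt (hq.1 i)
      rcases (hp.1 i).eq_or_lt with h0 | h0
      · simp [← h0, hsq]
      · have hs := Real.sqrt_pos.2 h0
        have ht := Real.sqrt_pos.2 (h i h0)
        have hlog : Real.log (p i / q i) = -(2 * Real.log (√(q i) / √(p i))) := by
          rw [Real.log_div h0.ne' (h i h0).ne', Real.log_div ht.ne' hs.ne',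
            Real.log_sqrt (hq.1 i), Real.log_sqrt (hp.1 i)]
          ring
        have hle := Real.log_le_sub_one_of_pos (div_pos ht hs)
        have hmul : p i * (√(q i) / √(p i)) = √(p i) * √(q i) := by
          rw [← hsp]
          field_simp
          simp [hs.le]
        rw [hlog]
        nlinarith [mul_le_mul_of_nonneg_left hle h0.le]
    refine (Finset.sum_le_sum fun i _ => hterm i).trans_eq ?_
    rw [Finset.sum_add_distrib, Finset.sum_sub_distrib, hp.2, hq.2]
    ring
  · exact le_top

lemma iidMeasure_apply (n K : ℕ) {p : Fin K → ℝ} (hp : ∀ i, 0 ≤ p i) (S : Set (Fin n → Fin K))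
    [DecidablePred (· ∈ S)] :
    iidMeasure n K p S = ENNReal.ofReal (∑ x, if x ∈ S then ∏ t, p (x t) else 0) := by
  have hnn : ∀ x : Fin n → Fin K, 0 ≤ ∏ t, p (x t) := fun x => Finset.prod_nonneg fun t _ => hp _
  rw [ENNReal.ofReal_sum_of_nonneg fun x _ => by split_ifs <;> simp [hnn x]]
  simp only [iidMeasure, Measure.finsetSum_apply, Measure.smul_apply, smul_eq_mul]
  refine Finset.sum_congr rfl fun x _ => ?_
  rw [Measure.dirac_apply' _ S.toFinite.measurableSet,
    ← ENNReal.ofReal_prod_of_nonneg fun t _ => hp _]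
  by_cases h : x ∈ S <;> simp [h]

/-- A ternary perturbation of the distribution putting mass `1/2` at `0` and spreading the rest
uniformly over the remaining `m` points. -/
noncomputable def perturbed {m : ℕ} (ε : ℝ) (v : Fin m → Fin 3) : Fin (m + 1) → ℝ :=
  Fin.cons (1 - ∑ i, (1 + ε * ((v i : ℕ) : ℝ)) / (2 * m))
    fun i => (1 + ε * ((v i : ℕ) : ℝ)) / (2 * m)

lemma perturbed_succ {m : ℕ} (ε : ℝ) (v : Fin m → Fin 3) (i : Fin m) :
    perturbed ε v i.succ = (1 + ε * ((v i : ℕ) : ℝ)) / (2 * m) := by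
  simp [perturbed]

lemma perturbed_zero {m : ℕ} (ε : ℝ) (v : Fin m → Fin 3) :
    perturbed ε v 0 = 1 - ∑ i : Fin m, perturbed ε v i.succ := by
  simp [perturbed]

lemma sum_perturbed {m : ℕ} (ε : ℝ) (v : Fin m → Fin 3) : ∑ i, perturbed ε v i = 1 := by
  rw [Fin.sum_univ_succ, perturbed_zero]
  ring

lemma cast_fin_three_mem (a : Fin 3) : (0 : ℝ) ≤ (a : ℕ) ∧ ((a : ℕ) : ℝ) ≤ 2 :=
  ⟨Nat.cast_nonneg _, by exact_mod_cast Nat.le_of_lt_succ a.isLt⟩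

lemma perturbed_succ_mem {m : ℕ} (hm : 0 < m) {ε : ℝ} (hε : 0 ≤ ε) (hε' : ε ≤ 1 / 4)
    (v : Fin m → Fin 3) (i : Fin m) :
    1 / (2 * (m : ℝ)) ≤ perturbed ε v i.succ ∧ perturbed ε v i.succ ≤ 3 / 4 / m := by
  have hm' : (0 : ℝ) < m := by exact_mod_cast hm
  obtain ⟨h0, h2⟩ := cast_fin_three_mem (v i)
  rw [perturbed_succ]
  constructor
  · gcongr
    nlinarith
  · rw [div_le_div_iff₀ (by positivity) hm']
    nlinarith [mul_le_mul hε' h2 h0 (by norm_num)]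

lemma quarter_le_perturbed_zero {m : ℕ} (hm : 0 < m) {ε : ℝ} (hε : 0 ≤ ε) (hε' : ε ≤ 1 / 4)
    (v : Fin m → Fin 3) : 1 / 4 ≤ perturbed ε v 0 := by
  have hm' : (0 : ℝ) < m := by exact_mod_cast hm
  have h := Finset.sum_le_sum fun i (_ : i ∈ Finset.univ) => (perturbed_succ_mem hm hε hε' v i).2
  rw [perturbed_zero]
  have : ∑ _i : Fin m, 3 / 4 / (m : ℝ) = 3 / 4 := by
    simp
    field_simp
  linarith

lemma perturbed_pos {m : ℕ} (hm : 0 < m) {ε : ℝ} (hε : 0 ≤ ε) (hε' : ε ≤ 1 / 4)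
    (v : Fin m → Fin 3) (i : Fin (m + 1)) : 0 < perturbed ε v i := by
  have hm' : (0 : ℝ) < m := by exact_mod_cast hm
  refine Fin.cases ?_ (fun j => ?_) i
  · linarith [quarter_le_perturbed_zero hm hε hε' v]
  · exact lt_of_lt_of_le (by positivity) (perturbed_succ_mem hm hε hε' v j).1

lemma perturbed_mem_simplex {m : ℕ} (hm : 0 < m) {ε : ℝ} (hε : 0 ≤ ε) (hε' : ε ≤ 1 / 4)
    (v : Fin m → Fin 3) : perturbed ε v ∈ simplex (m + 1) :=
  ⟨fun i => (perturbed_pos hm hε hε' v i).le, sum_perturbed ε v⟩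

/-- Shifting one coordinate of the parameter costs little in chi-square divergence. -/
lemma chiSq_perturbed_le {m : ℕ} (hm : 0 < m) {ε : ℝ} (hε : 0 ≤ ε) (hε' : ε ≤ 1 / 4)
    (v : Fin m → Fin 3) (j : Fin m) (a : Fin 3) :
    ∑ i, (perturbed ε (v + Pi.single j a) i - perturbed ε v i) ^ 2 / perturbed ε v i
      ≤ 6 * ε ^ 2 / m := by
  have hm' : (1 : ℝ) ≤ m := by exact_mod_cast hm
  set d : Fin m → ℝ := fun i =>
    perturbed ε (v + Pi.single j a) i.succ - perturbed ε v i.succ with hd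
  have hne : ∀ i, i ≠ j → d i = 0 := fun i hi => by simp [hd, perturbed_succ, hi]
  have hsq : d j ^ 2 ≤ (ε / m) ^ 2 := by
    obtain ⟨h0, h2⟩ := cast_fin_three_mem ((v + Pi.single j a : Fin m → Fin 3) j)
    obtain ⟨h0', h2'⟩ := cast_fin_three_mem (v j)
    have : d j = ε / m *
        (((((v + Pi.single j a : Fin m → Fin 3) j : Fin 3) : ℕ) - ((v j : ℕ) : ℝ)) / 2) := by
      simp only [hd, perturbed_succ]
      field_simp
      ring
    rw [this, mul_pow]
    refine mul_le_of_le_one_right (by positivity) ?_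
    rw [sq_le_one_iff_abs_le_one, abs_le]
    constructor <;> linarith
  have hzero : perturbed ε (v + Pi.single j a) 0 - perturbed ε v 0 = -d j := by
    have : ∑ i, d i = d j := Finset.sum_eq_single j (fun i _ hi => hne i hi) (by simp)
    rw [perturbed_zero, perturbed_zero, ← this, Finset.sum_sub_distrib]
    ring
  rw [Fin.sum_univ_succ, hzero, neg_sq, Finset.sum_eq_single j
    (fun i _ hi => by
      have := hne i hi
      simp only [hd] at this
      simp [this]) (by simp)]
  calc _ ≤ (ε / m) ^ 2 / (1 / 4) + (ε / m) ^ 2 / (1 / (2 * m)) := by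
        refine add_le_add ?_ ?_
        · exact div_le_div₀ (by positivity) hsq (by norm_num)
            (quarter_le_perturbed_zero hm hε hε' v)
        · exact div_le_div₀ (by positivity) hsq (by positivity) (perturbed_succ_mem hm hε hε' v j).1
    _ = (4 / m + 2) * (ε ^ 2 / m) := by
        field_simp
    _ ≤ 6 * (ε ^ 2 / m) := by
        gcongr
        have : 4 / (m : ℝ) ≤ 4 := div_le_self (by norm_num) hm'
        linarith
    _ = _ := by ring

/-- Distinct values of a coordinate have square-root masses too far apart to be both close to
the same number. -/
lemma eq_of_sq_sqrt_sub_lt {m : ℕ} (hm : 0 < m) {ε : ℝ} (hε : 0 ≤ ε) (hε' : ε ≤ 1 / 4)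
    {a b : Fin 3} {s : ℝ}
    (ha : (√((1 + ε * ((a : ℕ) : ℝ)) / (2 * m)) - s) ^ 2 < ε ^ 2 / (64 * m))
    (hb : (√((1 + ε * ((b : ℕ) : ℝ)) / (2 * m)) - s) ^ 2 < ε ^ 2 / (64 * m)) : a = b := by
  have hm' : (0 : ℝ) < m := by exact_mod_cast hm
  by_contra hab
  set A := (1 + ε * ((a : ℕ) : ℝ)) / (2 * m) with hA
  set B := (1 + ε * ((b : ℕ) : ℝ)) / (2 * m) with hB
  have hbound : ∀ c : Fin 3, 0 ≤ (1 + ε * ((c : ℕ) : ℝ)) / (2 * m) ∧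
      (1 + ε * ((c : ℕ) : ℝ)) / (2 * m) ≤ 1 / m := fun c => by
    obtain ⟨h0, h2⟩ := cast_fin_three_mem c
    refine ⟨by positivity, ?_⟩
    rw [div_le_div_iff₀ (by positivity) hm']
    nlinarith [mul_le_mul hε' h2 h0 (by norm_num)]
  have hsA := Real.sq_sqrt (hbound a).1
  have hsB := Real.sq_sqrt (hbound b).1
  have hdist : (1 : ℝ) ≤ (((a : ℕ) : ℝ) - ((b : ℕ) : ℝ)) ^ 2 := by
    fin_cases a <;> fin_cases b <;> first | exact absurd rfl hab | norm_num
  have hdiff : ε ^ 2 / (4 * m ^ 2) ≤ (A - B) ^ 2 := by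
    have : (A - B) ^ 2 = ε ^ 2 / (4 * m ^ 2) * (((a : ℕ) : ℝ) - ((b : ℕ) : ℝ)) ^ 2 := by
      rw [hA, hB]
      field_simp
      ring
    rw [this]
    exact le_mul_of_one_le_right (by positivity) hdist
  have hfactor : (A - B) ^ 2 = (√A - √B) ^ 2 * (√A + √B) ^ 2 := by
    rw [← mul_pow, mul_comm, ← sq_sub_sq, hsA, hsB]
  have hsum : (√A + √B) ^ 2 ≤ 4 / m := by
    have h4 : 4 / (m : ℝ) = 4 * (1 / m) := by ring
    have := (hbound a).2
    have := (hbound b).2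
    nlinarith [sq_nonneg (√A - √B)]
  have hclose : (√A - √B) ^ 2 < ε ^ 2 / (16 * m) := by
    have : ε ^ 2 / (16 * m) = 2 * (ε ^ 2 / (64 * m)) + 2 * (ε ^ 2 / (64 * m)) := by
      field_simp
      ring
    nlinarith [sq_nonneg ((√A - s) + (√B - s))]
  have : (A - B) ^ 2 < ε ^ 2 / (4 * m ^ 2) := by
    calc (A - B) ^ 2 ≤ (√A - √B) ^ 2 * (4 / m) := by
          rw [hfactor]
          gcongr
      _ < ε ^ 2 / (16 * m) * (4 / m) := by gcongr
      _ = _ := by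
          field_simp
          norm_num
  linarith

/-- For every estimator, some perturbed distribution is estimated with loss at least of order
`m / n` with probability at least one half. -/
lemma exists_half_le_iidMeasure {m n : ℕ} (hm : 0 < m) (hn : 0 < n) (hmn : (m : ℝ) ≤ 100 * n)
    (phat : (Fin n → Fin (m + 1)) → Fin (m + 1) → ℝ) (hphat : ∀ x, phat x ∈ simplex (m + 1)) :
    ∃ p ∈ simplex (m + 1), ENNReal.ofReal (1 / 2) ≤
      iidMeasure n (m + 1) p {x | ENNReal.ofReal (m / (960000 * n)) ≤ klD p (phat x)} := by
  classical
  have hm' : (0 : ℝ) < m := by exact_mod_cast hm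
  have hn' : (0 : ℝ) < n := by exact_mod_cast hn
  have : Nonempty (Fin m) := ⟨⟨0, hm⟩⟩
  obtain ⟨ε, hε, hε2⟩ : ∃ ε : ℝ, 0 ≤ ε ∧ ε ^ 2 = m / (2500 * n) :=
    ⟨√(m / (2500 * n)), Real.sqrt_nonneg _, Real.sq_sqrt (by positivity)⟩
  have hε' : ε ≤ 1 / 4 := by
    have : ε ^ 2 ≤ (1 / 4) ^ 2 := by
      rw [hε2, div_le_iff₀ (by positivity)]
      linarith
    exact le_of_sq_le_sq this (by norm_num)
  have hτ : ε ^ 2 / (64 * m) = 1 / (160000 * n) := by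
    rw [hε2]
    field_simp
    norm_num
  obtain ⟨v, hv⟩ := exists_half_le_sum_of_ternary
    (fun (v : Fin m → Fin 3) (x : Fin n → Fin (m + 1)) => ∏ t, perturbed ε v (x t))
    (fun v x => Finset.prod_nonneg fun t _ => (perturbed_pos hm hε hε' v _).le)
    (fun v => by rw [← Fintype.sum_pow, sum_perturbed, one_pow])
    (fun v j a => by
      refine le_of_sq_le_sq ?_ (by norm_num)
      refine (sq_sum_abs_prod_sub_prod_le n _ _ (perturbed_pos hm hε hε' v)
        (sum_perturbed _ _) (sum_perturbed _ _)).trans ?_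
      have hchi := chiSq_perturbed_le hm hε hε' v j a
      have hchi0 : 0 ≤ ∑ i, (perturbed ε (v + Pi.single j a) i - perturbed ε v i) ^ 2
          / perturbed ε v i :=
        Finset.sum_nonneg fun i _ => div_nonneg (sq_nonneg _) (perturbed_pos hm hε hε' v i).le
      have hval : 6 * ε ^ 2 / m = 6 / 2500 / n := by
        rw [hε2]
        field_simp
      rw [hval] at hchi
      have hpow : (1 + ∑ i, (perturbed ε (v + Pi.single j a) i - perturbed ε v i) ^ 2
          / perturbed ε v i) ^ n ≤ Real.exp (6 / 2500) := by
        calc _ ≤ (Real.exp (6 / 2500 / n)) ^ n := by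
              gcongr
              linarith [Real.add_one_le_exp (6 / 2500 / (n : ℝ))]
          _ = _ := by
              rw [← Real.exp_nat_mul]
              congr 1
              field_simp
      have hexp := Real.abs_exp_sub_one_le (x := 6 / 2500) (by norm_num [abs_le])
      rw [abs_of_pos (by norm_num : (0 : ℝ) < 6 / 2500)] at hexp
      have := le_abs_self (Real.exp (6 / 2500) - 1)
      linarith)
    (fun j a x => (√((1 + ε * ((a : ℕ) : ℝ)) / (2 * m)) - √(phat x j.succ)) ^ 2
      < ε ^ 2 / (64 * m))
    (fun j a b x ha hb => eq_of_sq_sqrt_sub_lt hm hε hε' ha hb)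
  have hsimp := perturbed_mem_simplex hm hε hε' v
  refine ⟨perturbed ε v, hsimp, ?_⟩
  rw [iidMeasure_apply n (m + 1) hsimp.1]
  refine ENNReal.ofReal_le_ofReal (hv.trans (Finset.sum_le_sum fun x _ => ?_))
  have hprod : 0 ≤ ∏ t, perturbed ε v (x t) := Finset.prod_nonneg fun t _ => hsimp.1 _
  split_ifs with h1 h2 h2
  · exact le_rfl
  · refine absurd ?_ h2
    refine le_trans (ENNReal.ofReal_le_ofReal ?_)
      (sum_sq_sqrt_sub_sqrt_le_klD hsimp (hphat x))
    rw [Fin.sum_univ_succ]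
    have hterm : ∀ j : Fin m, 1 / (160000 * (n : ℝ)) *
        (1 - if (√((1 + ε * ((v j : ℕ) : ℝ)) / (2 * m)) - √(phat x j.succ)) ^ 2
          < ε ^ 2 / (64 * m) then (1 : ℝ) else 0)
        ≤ (√(perturbed ε v j.succ) - √(phat x j.succ)) ^ 2 := by
      intro j
      rw [perturbed_succ, ← hτ]
      split_ifs with h
      · simpa using sq_nonneg _
      · simpa using h
    have hsum := Finset.sum_le_sum fun j (_ : j ∈ Finset.univ) => hterm j
    rw [← Finset.mul_sum, Finset.sum_sub_distrib] at hsum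
    simp only [Finset.sum_const, Finset.card_univ, Fintype.card_fin, nsmul_eq_mul, mul_one]
      at hsum h1
    have hval : (m : ℝ) / (960000 * n) = 1 / (160000 * n) * (m - 5 / 6 * m) := by
      field_simp
      norm_num
    have hmono : 1 / (160000 * (n : ℝ)) * (m - 5 / 6 * m) ≤ _ :=
      (mul_le_mul_of_nonneg_left (sub_le_sub_left h1 (m : ℝ)) (by positivity)).trans hsum
    linarith [sq_nonneg (√(perturbed ε v 0) - √(phat x 0))]
  · exact hprod
  · exact le_rfl


/-- parametric minimax lower bound of order K/n. -/
theorem parametric_lower_bound :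
    ∃ C : ℝ, 0 < C ∧
      ∀ (K : ℕ), 2 ≤ K → ∀ δ : ℝ, δ ∈ Set.Ioo (0 : ℝ) (1/2) →
      ∀ n : ℕ, Real.log 2 / 2 * (K : ℝ) ^ 2 ≤ (n : ℝ) →
      ENNReal.ofReal (C * K / n) ≤ minimaxRate n K δ := by
  refine ⟨1 / 2000000, by norm_num, fun K hK δ hδ n hn => ?_⟩
  obtain ⟨m, rfl⟩ : ∃ m, K = m + 1 := ⟨K - 1, by omega⟩
  have hm : 0 < m := by omega
  have hm' : (1 : ℝ) ≤ m := by exact_mod_cast hm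
  push_cast at hn ⊢
  have hnm : (m : ℝ) ≤ 100 * n ∧ (0 : ℝ) < n := by
    have := Real.log_two_gt_d9
    constructor <;> nlinarith [sq_nonneg ((m : ℝ) + 1)]
  refine le_iInf fun phat => le_iInf₂ fun r hr => ?_
  by_contra! hlt
  obtain ⟨p, hp, hhalf⟩ := exists_half_le_iidMeasure hm (by exact_mod_cast hnm.2) hnm.1
    phat.1 phat.2
  have hsub : {x | ENNReal.ofReal (m / (960000 * n)) ≤ klD p (phat.1 x)}
      ⊆ {x | r < klD p (phat.1 x)} := by
    intro x hx
    refine lt_of_lt_of_le (hlt.trans_le (ENNReal.ofReal_le_ofReal ?_)) hx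
    rw [div_le_div_iff₀ hnm.2 (by nlinarith [hnm.2])]
    nlinarith [hnm.2]
  have h1 := (hhalf.trans (measure_mono hsub)).trans
    ((le_iSup (fun p : {p : Fin (m + 1) → ℝ // p ∈ simplex (m + 1)} =>
      iidMeasure n (m + 1) p.val {x | r < klD p.val (phat.1 x)}) ⟨p, hp⟩).trans hr)
  have h2 := (ENNReal.ofReal_le_ofReal_iff hδ.1.le).1 h1
  linarith [hδ.2]
end

section
/- Let 𝒥̃ = {i ∈ [K] : n·p*(i) < 32·log(K/δ)} and suppose |𝒥̃| = 0, i.e. n·p*(i) ≥ 32·log(K/δ) for every i ∈ [K]. Then there is an absolute constant C > 0 such that, with probability at least 1 − δ over the n i.i.d. samples from p*, the maximum likelihood estimator p̄_n satisfies KL(p*‖p̄_n) ≤ C·(K + log(1/δ))/n, and moreover, with probability at least 1 − δ, (1/6)·χ²(p*‖p̄_n) ≤ (1/4)·χ²(p̄_n‖p*) ≤ KL(p*‖p̄_n) ≤ (5/2)·H²(p*‖p̄_n) ≤ (5/2)·KL(p̄_n‖p*) ≤ (5/2)·χ²(p̄_n‖p*) ≤ 5·χ²(p*‖p̄_n). 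-/
open scoped ENNReal
open MeasureTheory

/-- Real-valued Kullback–Leibler divergence `∑ p(i)·log(p(i)/q(i))`. -/
noncomputable def klReal {K : ℕ} (p q : Fin K → ℝ) : ℝ :=
  ∑ i, p i * Real.log (p i / q i)

/-- Chi-squared divergence `χ²(a‖b) = ∑ (a(i) - b(i))²/b(i)`. -/
noncomputable def chiSq {K : ℕ} (a b : Fin K → ℝ) : ℝ :=
  ∑ i, (a i - b i) ^ 2 / b i

/-- Squared Hellinger distance `H²(p‖q) = ∑ (√p(i) - √q(i))²`. -/
noncomputable def hellSq {K : ℕ} (p q : Fin K → ℝ) : ℝ :=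
  ∑ i, (Real.sqrt (p i) - Real.sqrt (q i)) ^ 2

/-! ### Scalar inequalities -/

/-- A function whose derivative has the sign of `x - 1` on an interval is minimal at `1`. -/
lemma le_of_hasDerivAt_sub_one_mul {f g : ℝ → ℝ} {a b x : ℝ} (ha : a ≤ 1) (hb : 1 ≤ b)
    (hf : ∀ y ∈ Set.Icc a b, HasDerivAt f ((y - 1) * g y) y)
    (hg : ∀ y ∈ Set.Icc a b, 0 ≤ g y) (hx : x ∈ Set.Icc a b) : f 1 ≤ f x := by
  rcases le_total x 1 with h | h
  · have hsub : Set.Icc a 1 ⊆ Set.Icc a b := Set.Icc_subset_Icc_right hb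
    refine antitoneOn_of_hasDerivWithinAt_nonpos (f' := fun y => (y - 1) * g y) (convex_Icc a 1)
      (fun y hy => (hf y (hsub hy)).continuousAt.continuousWithinAt)
      (fun y hy => (hf y (hsub (interior_subset hy))).hasDerivWithinAt)
      (fun y hy => ?_) ⟨hx.1, h⟩ ⟨ha, le_rfl⟩ h
    have hy' := interior_subset hy
    exact mul_nonpos_of_nonpos_of_nonneg (by linarith [hy'.2]) (hg y (hsub hy'))
  · have hsub : Set.Icc 1 b ⊆ Set.Icc a b := Set.Icc_subset_Icc_left ha
    refine monotoneOn_of_hasDerivWithinAt_nonneg (f' := fun y => (y - 1) * g y) (convex_Icc 1 b)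
      (fun y hy => (hf y (hsub hy)).continuousAt.continuousWithinAt)
      (fun y hy => (hf y (hsub (interior_subset hy))).hasDerivWithinAt)
      (fun y hy => ?_) ⟨le_rfl, hb⟩ ⟨h, hx.2⟩ h
    have hy' := interior_subset hy
    exact mul_nonneg (by linarith [hy'.1]) (hg y (hsub hy'))

lemma log_add_sq_div_four_le {r : ℝ} (h0 : 0 < r) (h2 : r ≤ 2) :
    Real.log r + (r - 1) ^ 2 / 4 ≤ r - 1 := by
  have key := le_of_hasDerivAt_sub_one_mul
    (f := fun y => y - 1 - Real.log y - (y - 1) ^ 2 / 4) (g := fun y => y⁻¹ - 1 / 2)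
    (a := min r 1) (b := 2) (x := r) (min_le_right _ _) (by norm_num) ?_ ?_ ⟨min_le_left _ _, h2⟩
  · norm_num at key
    linarith
  · intro y hy
    have hy0 : 0 < y := (lt_min h0 one_pos).trans_le hy.1
    have hd := (((hasDerivAt_id y).sub_const 1).sub (Real.hasDerivAt_log hy0.ne')).sub
      ((((hasDerivAt_id y).sub_const 1).pow 2).div_const 4)
    refine hd.congr_deriv ?_
    simp only [id]
    field_simp
    ring
  · intro y hy
    have hy0 : 0 < y := (lt_min h0 one_pos).trans_le hy.1
    have : (2 : ℝ)⁻¹ ≤ y⁻¹ := inv_anti₀ hy0 hy.2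
    norm_num at this ⊢
    linarith

lemma sq_sub_one_le_log_add {s : ℝ} (hs : 2 / 3 ≤ s) :
    s ^ 2 - 1 ≤ 2 * Real.log s + 5 / 2 * (s - 1) ^ 2 := by
  have key := le_of_hasDerivAt_sub_one_mul
    (f := fun y => 2 * Real.log y + 5 / 2 * (y - 1) ^ 2 - y ^ 2) (g := fun y => 3 - 2 * y⁻¹)
    (a := 2 / 3) (b := max s 1) (x := s) (by norm_num) (le_max_right _ _) ?_ ?_
    ⟨hs, le_max_left _ _⟩
  · norm_num at key
    linarith
  · intro y hy
    have hy0 : 0 < y := lt_of_lt_of_le (by norm_num) hy.1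
    have hd := (((Real.hasDerivAt_log hy0.ne').const_mul 2).add
      ((((hasDerivAt_id y).sub_const 1).pow 2).const_mul (5 / 2))).sub ((hasDerivAt_id y).pow 2)
    refine hd.congr_deriv ?_
    simp only [id]
    field_simp
    ring
  · intro y hy
    have : y⁻¹ ≤ (2 / 3 : ℝ)⁻¹ := inv_anti₀ (by norm_num) hy.1
    norm_num at this
    linarith

/-- Coordinatewise comparison of the summands of the divergences of `p` and `q`, when `q / p` lies
in `[2/3, 2]`. The terms `q - p` cancel after summation. -/
lemma divergence_summands {p q : ℝ} (hp : 0 < p) (hlo : 2 / 3 * p ≤ q) (hhi : q ≤ 2 * p) :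
    (1 / 6 : ℝ) * ((p - q) ^ 2 / q) ≤ 1 / 4 * ((q - p) ^ 2 / p) ∧
    (1 / 4 : ℝ) * ((q - p) ^ 2 / p) ≤ p * Real.log (p / q) + (q - p) ∧
    p * Real.log (p / q) + (q - p) ≤ 5 / 2 * (√p - √q) ^ 2 ∧
    (√p - √q) ^ 2 ≤ q * Real.log (q / p) - (q - p) ∧
    q * Real.log (q / p) - (q - p) ≤ (q - p) ^ 2 / p ∧
    (q - p) ^ 2 / p ≤ 2 * ((p - q) ^ 2 / q) := by
  have hq : 0 < q := by linarith
  obtain ⟨r, rfl⟩ : ∃ r, q = p * r ^ 2 := ⟨√(q / p), by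
    rw [Real.sq_sqrt (by positivity)]; field_simp⟩
  wlog hr : 0 < r generalizing r
  · have h := this (-r) (by rwa [neg_sq]) (by rwa [neg_sq]) (by rwa [neg_sq]) ?_
    · rwa [neg_sq] at h
    · have : r ≠ 0 := by rintro rfl; simp at hq
      exact neg_pos.2 (lt_of_le_of_ne (not_lt.1 hr) this)
  have hr2 : 0 < r ^ 2 := by positivity
  have hlo' : 2 / 3 ≤ r ^ 2 := by
    by_contra! h
    nlinarith
  have hhi' : r ^ 2 ≤ 2 := by
    by_contra! h
    nlinarith
  have e1 : p / (p * r ^ 2) = (r ^ 2)⁻¹ := by field_simp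
  have e2 : p * r ^ 2 / p = r ^ 2 := by field_simp
  have e3 : √(p * r ^ 2) = √p * r := by rw [Real.sqrt_mul hp.le, Real.sqrt_sq hr.le]
  have e4 : (√p - √p * r) ^ 2 = p * (r - 1) ^ 2 := by
    calc (√p - √p * r) ^ 2 = √p ^ 2 * (r - 1) ^ 2 := by ring
      _ = _ := by rw [Real.sq_sqrt hp.le]
  have e5 : (p * r ^ 2 - p) ^ 2 / p = p * (r ^ 2 - 1) ^ 2 := by field_simp
  have e6 : (p - p * r ^ 2) ^ 2 / (p * r ^ 2) = p * ((r ^ 2 - 1) ^ 2 / r ^ 2) := by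
    field_simp
    ring
  have hl : Real.log (r ^ 2) = 2 * Real.log r := by simp
  rw [e1, e2, e3, e4, e5, e6, Real.log_inv]
  have h1 : (r ^ 2 - 1) ^ 2 / r ^ 2 ≤ 3 / 2 * (r ^ 2 - 1) ^ 2 := by
    rw [div_le_iff₀ hr2]
    nlinarith [sq_nonneg (r ^ 2 - 1)]
  have h6 : (r ^ 2 - 1) ^ 2 ≤ 2 * ((r ^ 2 - 1) ^ 2 / r ^ 2) := by
    rw [← mul_div_assoc, le_div_iff₀ hr2]
    nlinarith [sq_nonneg (r ^ 2 - 1)]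
  have h2 := log_add_sq_div_four_le hr2 hhi'
  have h3 : r ^ 2 - 1 ≤ Real.log (r ^ 2) + 5 / 2 * (r - 1) ^ 2 := by
    rw [hl]
    exact sq_sub_one_le_log_add (by nlinarith)
  have h4 : 2 * r ^ 2 - 2 * r ≤ r ^ 2 * Real.log (r ^ 2) := by
    have h := mul_le_mul_of_nonneg_left (Real.one_sub_inv_le_log_of_pos hr) hr2.le
    have : r ^ 2 * (1 - r⁻¹) = r ^ 2 - r := by field_simp
    rw [hl]
    linarith
  have h5 : r ^ 2 * Real.log (r ^ 2) ≤ r ^ 2 * (r ^ 2 - 1) :=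
    mul_le_mul_of_nonneg_left (Real.log_le_sub_one_of_pos hr2) hr2.le
  refine ⟨?_, ?_, ?_, ?_, ?_, ?_⟩
  · nlinarith [mul_le_mul_of_nonneg_left h1 hp.le]
  · nlinarith [mul_le_mul_of_nonneg_left h2 hp.le]
  · nlinarith [mul_le_mul_of_nonneg_left h3 hp.le]
  · nlinarith [mul_le_mul_of_nonneg_left h4 hp.le]
  · nlinarith [mul_le_mul_of_nonneg_left h5 hp.le]
  · nlinarith [mul_le_mul_of_nonneg_left h6 hp.le]

/-- The chain of comparisons between divergences for vectors with ratio in `[2/3, 2]`. -/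
lemma divergence_chain {K : ℕ} {p q : Fin K → ℝ} (hpq : ∑ i, q i = ∑ i, p i)
    (hp : ∀ i, 0 < p i) (hlo : ∀ i, 2 / 3 * p i ≤ q i) (hhi : ∀ i, q i ≤ 2 * p i) :
    (1 / 6 : ℝ) * chiSq p q ≤ (1 / 4) * chiSq q p ∧
    (1 / 4 : ℝ) * chiSq q p ≤ klReal p q ∧
    klReal p q ≤ (5 / 2) * hellSq p q ∧
    hellSq p q ≤ klReal q p ∧
    klReal q p ≤ chiSq q p ∧
    chiSq q p ≤ 2 * chiSq p q := by
  have h := fun i => divergence_summands (hp i) (hlo i) (hhi i)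
  have k1 : klReal p q = ∑ i, (p i * Real.log (p i / q i) + (q i - p i)) := by
    simp [klReal, Finset.sum_add_distrib, hpq]
  have k2 : klReal q p = ∑ i, (q i * Real.log (q i / p i) - (q i - p i)) := by
    simp [klReal, Finset.sum_sub_distrib, hpq]
  rw [k1, k2]
  simp only [chiSq, hellSq, Finset.mul_sum]
  exact ⟨Finset.sum_le_sum fun i _ => (h i).1, Finset.sum_le_sum fun i _ => (h i).2.1,
    Finset.sum_le_sum fun i _ => (h i).2.2.1, Finset.sum_le_sum fun i _ => (h i).2.2.2.1,
    Finset.sum_le_sum fun i _ => (h i).2.2.2.2.1, Finset.sum_le_sum fun i _ => (h i).2.2.2.2.2⟩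

/-- Some integer tilt captures the Gaussian-type exponent of a count `N` with mean `s ^ 2`. -/
lemma exists_int_tilt {s N : ℝ} (hs : 0 < s) (h0 : 0 ≤ N) (h2 : N ≤ 2 * s ^ 2) :
    ∃ j : ℤ, |(j : ℝ)| ≤ s ∧ (N - s ^ 2) ^ 2 / (16 * s ^ 2) - 1 ≤
      -|(j : ℝ)| + (j / s * N - s ^ 2 * (Real.exp (j / s) - 1)) := by
  set z := (N - s ^ 2) / s with hz
  have hzs : |z| ≤ s := by
    rw [hz, abs_div, abs_of_pos hs, div_le_iff₀ hs, abs_le]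
    constructor <;> nlinarith
  obtain ⟨j, hj1, hj2, hj3⟩ : ∃ j : ℤ, |(j : ℝ)| ≤ |z| / 4 ∧ |z| / 4 - 1 < |(j : ℝ)| ∧
      |(j : ℝ)| * |z| = j * z := by
    have hfl := Int.floor_le (|z| / 4)
    have hlt := Int.sub_one_lt_floor (|z| / 4)
    have hnn : (0 : ℝ) ≤ ⌊|z| / 4⌋ := by exact_mod_cast Int.floor_nonneg.2 (by positivity)
    rcases le_total 0 z with h | h
    · refine ⟨⌊|z| / 4⌋, ?_⟩
      rw [abs_of_nonneg hnn]
      exact ⟨hfl, hlt, by rw [abs_of_nonneg h]⟩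
    · refine ⟨-⌊|z| / 4⌋, ?_⟩
      rw [Int.cast_neg, abs_neg, abs_of_nonneg hnn]
      exact ⟨hfl, hlt, by rw [abs_of_nonpos h]; ring⟩
  have hju : |(j : ℝ)| ≤ s := by linarith [abs_nonneg z]
  refine ⟨j, hju, ?_⟩
  have ha : |(j : ℝ) / s| ≤ 1 := by
    rw [abs_div, abs_of_pos hs, div_le_one hs]
    exact hju
  have he := (abs_le.1 (Real.abs_exp_sub_one_sub_id_le ha)).2
  have hm := mul_le_mul_of_nonneg_left he (sq_nonneg s)
  have e1 : s ^ 2 * ((j : ℝ) / s) ^ 2 = |(j : ℝ)| ^ 2 := by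
    rw [sq_abs]
    field_simp
  have e2 : (j : ℝ) / s * N - s ^ 2 * (j / s) = |(j : ℝ)| * |z| := by
    rw [hj3, hz]
    field_simp
  have e3 : (N - s ^ 2) ^ 2 / (16 * s ^ 2) = |z| ^ 2 / 16 := by
    rw [sq_abs, hz]
    field_simp
  rw [e3]
  have hu := abs_nonneg (j : ℝ)
  have hv := abs_nonneg z
  generalize |(j : ℝ)| = u at *
  generalize |z| = v at *
  have hmain : v ^ 2 / 16 - 1 ≤ -u + (u * v - u ^ 2) := by
    rcases le_total v (4 / 3) with h | h
    · nlinarith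
    · rcases le_total v 4 with h' | h'
      · nlinarith [mul_nonneg hu (by linarith : 0 ≤ 3 * v / 4 - 1)]
      · nlinarith [mul_nonneg hu (by linarith : 0 ≤ v / 4 - u),
          mul_nonneg (by linarith : 0 ≤ u - (v / 4 - 1)) (by linarith : 0 ≤ 3 * v / 4 - 1),
          sq_nonneg (v / 4 - 1)]
  nlinarith

/-! ### Exponential moments of the counts -/

/-- Expectation of `F` under `n` i.i.d. samples from `p`, as a finite sum. -/
noncomputable def iidExp {n K : ℕ} (p : Fin K → ℝ) (F : (Fin n → Fin K) → ℝ) : ℝ :=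
  ∑ x, (∏ t, p (x t)) * F x

/-- Likelihood ratio of the Poissonized counts under the exponential tilt `a`. -/
noncomputable def poissonTilt {n K : ℕ} (p a : Fin K → ℝ) (x : Fin n → Fin K) : ℝ :=
  Real.exp (∑ i, (a i * countTo x n i - n * p i * (Real.exp (a i) - 1)))

lemma iidExp_add {n K : ℕ} (p : Fin K → ℝ) (F G : (Fin n → Fin K) → ℝ) :
    iidExp p (fun x => F x + G x) = iidExp p F + iidExp p G := by
  simp [iidExp, mul_add, Finset.sum_add_distrib]

lemma iidExp_const_mul {n K : ℕ} (p : Fin K → ℝ) (c : ℝ) (F : (Fin n → Fin K) → ℝ) :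
    iidExp p (fun x => c * F x) = c * iidExp p F := by
  simp [iidExp, Finset.mul_sum, mul_left_comm]

lemma iidExp_sum {n K : ℕ} {ι : Type*} (p : Fin K → ℝ) (s : Finset ι)
    (F : ι → (Fin n → Fin K) → ℝ) :
    iidExp p (fun x => ∑ j ∈ s, F j x) = ∑ j ∈ s, iidExp p (F j) := by
  simp only [iidExp, Finset.mul_sum]
  exact Finset.sum_comm

lemma sum_prod_eq_pow {n K : ℕ} (g : Fin K → ℝ) :
    ∑ x : Fin n → Fin K, ∏ t, g (x t) = (∑ i, g i) ^ n := by
  rw [← Fintype.piFinset_univ, Finset.sum_prod_piFinset]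
  simp

lemma countTo_eq {n K : ℕ} (x : Fin n → Fin K) (i : Fin K) :
    (countTo x n i : ℝ) = ∑ t, if x t = i then 1 else 0 := by
  simp [countTo]

lemma sum_mul_countTo {n K : ℕ} (a : Fin K → ℝ) (x : Fin n → Fin K) :
    ∑ i, a i * countTo x n i = ∑ t, a (x t) := by
  simp only [countTo_eq, Finset.mul_sum]
  rw [Finset.sum_comm]
  simp

lemma iidExp_poissonTilt_le {n K : ℕ} {p : Fin K → ℝ} (hp : p ∈ simplex K) (a : Fin K → ℝ) :
    iidExp (n := n) p (poissonTilt p a) ≤ 1 := by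
  have h1 : ∀ x : Fin n → Fin K, (∏ t, p (x t)) * poissonTilt p a x =
      (∏ t, p (x t) * Real.exp (a (x t))) * Real.exp (-(n * (∑ i, p i * Real.exp (a i) - 1))) := by
    intro x
    rw [poissonTilt, Finset.prod_mul_distrib, ← Real.exp_sum, mul_assoc, ← Real.exp_add]
    congr 2
    have h2 : ∑ i, (n : ℝ) * p i * (Real.exp (a i) - 1) = n * (∑ i, p i * Real.exp (a i) - 1) := by
      simp only [mul_assoc, ← Finset.mul_sum, mul_sub, Finset.sum_sub_distrib, mul_one, hp.2]
    rw [Finset.sum_sub_distrib, sum_mul_countTo, h2]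
    ring
  rw [iidExp, Finset.sum_congr rfl fun x _ => h1 x, ← Finset.sum_mul,
    sum_prod_eq_pow (fun i => p i * Real.exp (a i)), Real.exp_neg, ← div_eq_mul_inv,
    div_le_one (Real.exp_pos _), Real.exp_nat_mul]
  refine pow_le_pow_left₀ (Finset.sum_nonneg fun i _ => mul_nonneg (hp.1 i) (Real.exp_pos _).le) ?_ n
  linarith [Real.add_one_le_exp (∑ i, p i * Real.exp (a i) - 1)]

/-- Bounding the failure probability by an expectation. -/
lemma one_sub_le_iidMeasure {n K : ℕ} {p : Fin K → ℝ} (hp : p ∈ simplex K) {δ : ℝ}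
    {S : Set (Fin n → Fin K)} {B : (Fin n → Fin K) → ℝ} (hB0 : ∀ x, 0 ≤ B x)
    (hB1 : ∀ x ∉ S, 1 ≤ B x) (hB : iidExp p B ≤ δ) :
    1 - ENNReal.ofReal δ ≤ iidMeasure n K p S := by
  classical
  have hw : ∀ x : Fin n → Fin K, 0 ≤ ∏ t, p (x t) := fun x => Finset.prod_nonneg fun t _ => hp.1 _
  have hS : iidMeasure n K p S =
      ENNReal.ofReal (∑ x : Fin n → Fin K, (∏ t, p (x t)) * if x ∈ S then 1 else 0) := by
    rw [ENNReal.ofReal_sum_of_nonneg fun x _ => mul_nonneg (hw x) (by split_ifs <;> simp)]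
    simp only [iidMeasure, Measure.coe_finsetSum, Finset.sum_apply, Measure.smul_apply,
      smul_eq_mul, Measure.dirac_apply' _ S.toFinite.measurableSet]
    refine Finset.sum_congr rfl fun x _ => ?_
    rw [ENNReal.ofReal_mul (hw x), ENNReal.ofReal_prod_of_nonneg fun t _ => hp.1 _]
    by_cases hx : x ∈ S <;> simp [hx]
  have htot : ∑ x : Fin n → Fin K, ∏ t, p (x t) = 1 := by
    rw [sum_prod_eq_pow, hp.2, one_pow]
  rw [hS, ← ENNReal.ofReal_one, tsub_le_iff_right, ← ENNReal.ofReal_add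
    (Finset.sum_nonneg fun x _ => mul_nonneg (hw x) (by split_ifs <;> simp))
    ((Finset.sum_nonneg fun x _ => mul_nonneg (hw x) (hB0 x)).trans hB)]
  refine ENNReal.ofReal_le_ofReal ?_
  calc (1 : ℝ) = ∑ x : Fin n → Fin K, ∏ t, p (x t) := htot.symm
    _ ≤ ∑ x : Fin n → Fin K, ((∏ t, p (x t)) * (if x ∈ S then 1 else 0) + (∏ t, p (x t)) * B x) := by
        refine Finset.sum_le_sum fun x _ => ?_
        rw [← mul_add]
        refine le_mul_of_one_le_right (hw x) ?_
        by_cases hx : x ∈ S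
        · simpa [hx] using hB0 x
        · simpa [hx] using hB1 x hx
    _ ≤ _ := by
        rw [Finset.sum_add_distrib]
        exact add_le_add le_rfl hB

/-- Mixture of Poisson tilts over integer multiples of the inverse standard deviations. -/
noncomputable def tiltMixture {n K : ℕ} (p : Fin K → ℝ) (T : Finset ℤ) (x : Fin n → Fin K) : ℝ :=
  ∑ j ∈ Fintype.piFinset fun _ : Fin K => T,
    (∏ i, Real.exp (-|(j i : ℝ)|)) * poissonTilt p (fun i => j i / √(n * p i)) x

lemma tiltMixture_nonneg {n K : ℕ} (p : Fin K → ℝ) (T : Finset ℤ) (x : Fin n → Fin K) :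
    0 ≤ tiltMixture p T x :=
  Finset.sum_nonneg fun _ _ => mul_nonneg (Finset.prod_nonneg fun _ _ => (Real.exp_pos _).le)
    (Real.exp_pos _).le

lemma iidExp_tiltMixture_le {n K : ℕ} {p : Fin K → ℝ} (hp : p ∈ simplex K) (T : Finset ℤ) :
    iidExp (n := n) p (tiltMixture p T) ≤ (∑ j ∈ T, Real.exp (-|(j : ℝ)|)) ^ K := by
  unfold tiltMixture
  rw [iidExp_sum]
  simp only [iidExp_const_mul]
  calc _ ≤ ∑ j ∈ Fintype.piFinset fun _ : Fin K => T, ∏ i, Real.exp (-|(j i : ℝ)|) := by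
        refine Finset.sum_le_sum fun j _ => mul_le_of_le_one_right
          (Finset.prod_nonneg fun _ _ => (Real.exp_pos _).le) (iidExp_poissonTilt_le hp _)
    _ = _ := by
        rw [Finset.sum_prod_piFinset T fun _ j => Real.exp (-|(j : ℝ)|)]
        simp

lemma exp_le_tiltMixture {n K : ℕ} {p : Fin K → ℝ} {x : Fin n → Fin K} (hp : p ∈ simplex K)
    (hpos : ∀ i, 0 < n * p i) (hx : ∀ i, (countTo x n i : ℝ) ≤ 2 * (n * p i)) :
    Real.exp (∑ i, (countTo x n i - n * p i) ^ 2 / (16 * (n * p i)) - K) ≤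
      tiltMixture p (Finset.Icc (-n) n) x := by
  have hex : ∀ i, ∃ j : ℤ, |(j : ℝ)| ≤ √(n * p i) ∧
      (countTo x n i - n * p i) ^ 2 / (16 * (n * p i)) - 1 ≤ -|(j : ℝ)| +
        (j / √(n * p i) * countTo x n i - n * p i * (Real.exp (j / √(n * p i)) - 1)) := by
    intro i
    have h := exists_int_tilt (Real.sqrt_pos.2 (hpos i)) (N := countTo x n i) (by positivity)
      (by rw [Real.sq_sqrt (hpos i).le]; exact hx i)
    rwa [Real.sq_sqrt (hpos i).le] at h
  choose j hj1 hj2 using hex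
  have hmem : j ∈ Fintype.piFinset fun _ : Fin K => Finset.Icc (-(n : ℤ)) n := by
    rw [Fintype.mem_piFinset]
    intro i
    have hpi : p i ≤ 1 := hp.2 ▸ Finset.single_le_sum (fun i _ => hp.1 i) (Finset.mem_univ i)
    have hn0 : (0 : ℝ) ≤ n := n.cast_nonneg
    have hn1 : (n : ℝ) ≤ n ^ 2 := by exact_mod_cast Nat.le_self_pow two_ne_zero n
    have h1 : √(n * p i) ≤ n := Real.sqrt_le_iff.2 ⟨hn0, by nlinarith⟩
    have h2 := abs_le.1 ((hj1 i).trans h1)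
    rw [Finset.mem_Icc]
    exact ⟨by exact_mod_cast h2.1, by exact_mod_cast h2.2⟩
  refine le_trans ?_ (Finset.single_le_sum (f := fun j : Fin K → ℤ =>
    (∏ i, Real.exp (-|(j i : ℝ)|)) * poissonTilt p (fun i => j i / √(n * p i)) x)
    (fun j _ => mul_nonneg (Finset.prod_nonneg fun _ _ => (Real.exp_pos _).le)
      (Real.exp_pos _).le) hmem)
  rw [poissonTilt, ← Real.exp_sum, ← Real.exp_add, ← Finset.sum_add_distrib]
  refine Real.exp_le_exp.2 ?_
  have := Finset.sum_le_sum fun i (_ : i ∈ Finset.univ) => hj2 i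
  rw [Finset.sum_sub_distrib] at this
  simpa using this

lemma summable_exp_neg_abs_int : Summable fun j : ℤ => Real.exp (-|(j : ℝ)|) := by
  refine Summable.of_nat_of_neg ?_ ?_ <;> simpa using Real.summable_exp_neg_nat

/-! ### Control of the ratios of empirical to true probabilities -/

/-- Sum of the Chernoff bounds on the events that some ratio leaves `[2/3, 2]`. -/
noncomputable def ratioPenalty {n K : ℕ} (p : Fin K → ℝ) (ε : ℝ) (x : Fin n → Fin K) : ℝ :=
  ∑ i, (ε ^ 2 * poissonTilt p (Pi.single i (Real.log (2 / 3))) x +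
    ε ^ 3 * poissonTilt p (Pi.single i (Real.log 2)) x)

lemma ratioPenalty_nonneg {n K : ℕ} (p : Fin K → ℝ) {ε : ℝ} (hε : 0 ≤ ε) (x : Fin n → Fin K) :
    0 ≤ ratioPenalty p ε x := by
  unfold ratioPenalty poissonTilt
  positivity

lemma iidExp_ratioPenalty_le {n K : ℕ} {p : Fin K → ℝ} (hp : p ∈ simplex K) {ε : ℝ}
    (hε : 0 ≤ ε) : iidExp (n := n) p (ratioPenalty p ε) ≤ K * (ε ^ 2 + ε ^ 3) := by
  unfold ratioPenalty
  rw [iidExp_sum]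
  simp only [iidExp_add, iidExp_const_mul]
  calc _ ≤ ∑ _i : Fin K, (ε ^ 2 + ε ^ 3) := Finset.sum_le_sum fun i _ =>
        add_le_add (mul_le_of_le_one_right (by positivity) (iidExp_poissonTilt_le hp _))
          (mul_le_of_le_one_right (by positivity) (iidExp_poissonTilt_le hp _))
    _ = _ := by rw [Finset.sum_const, Finset.card_univ, Fintype.card_fin, nsmul_eq_mul]

lemma poissonTilt_single {n K : ℕ} (p : Fin K → ℝ) (i : Fin K) (c : ℝ) (x : Fin n → Fin K) :
    poissonTilt p (Pi.single i c) x =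
      Real.exp (c * countTo x n i - n * p i * (Real.exp c - 1)) := by
  rw [poissonTilt, Finset.sum_eq_single i]
  · simp
  · intro j _ hj
    simp [Pi.single_eq_of_ne hj]
  · simp

lemma log_three_halves_le : Real.log (3 / 2) ≤ 13 / 32 := by
  rw [Real.log_le_iff_le_exp (by norm_num)]
  refine le_trans ?_ (Real.sum_le_exp_of_nonneg (by norm_num) 5)
  norm_num [Finset.sum_range_succ, Nat.factorial]

lemma one_le_ratioPenalty {n K : ℕ} {p : Fin K → ℝ} {ε : ℝ} (hε : 0 < ε) (hε1 : ε ≤ 1)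
    (hp : ∀ i, 32 * Real.log ε⁻¹ ≤ n * p i) {x : Fin n → Fin K} {i : Fin K}
    (hx : ¬ (2 / 3 * (n * p i) ≤ countTo x n i ∧ (countTo x n i : ℝ) ≤ 2 * (n * p i))) :
    1 ≤ ratioPenalty p ε x := by
  have hm0 : 0 ≤ n * p i := le_trans (by
    have := Real.log_nonneg ((one_le_inv₀ hε).2 hε1)
    positivity) (hp i)
  have hpow : ∀ (k : ℕ) (c : ℝ), k * Real.log ε⁻¹ ≤ c → 1 ≤ ε ^ k * Real.exp c := by
    intro k c h
    have h1 := Real.exp_le_exp.2 h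
    rw [Real.exp_nat_mul, Real.exp_log (by positivity), inv_pow] at h1
    calc (1 : ℝ) = ε ^ k * (ε ^ k)⁻¹ := (mul_inv_cancel₀ (by positivity)).symm
      _ ≤ _ := by gcongr
  have hterm : 1 ≤ ε ^ 2 * poissonTilt p (Pi.single i (Real.log (2 / 3))) x +
      ε ^ 3 * poissonTilt p (Pi.single i (Real.log 2)) x := by
    rw [poissonTilt_single, poissonTilt_single, Real.exp_log (by norm_num),
      Real.exp_log (by norm_num)]
    have hi := hp i
    rcases not_and_or.1 hx with h | h
    · push Not at h
      refine le_add_of_le_of_nonneg (hpow 2 _ ?_) (by positivity)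
      have e : Real.log (2 / 3) = -Real.log (3 / 2) := by rw [← Real.log_inv]; norm_num
      have hl := log_three_halves_le
      have hl0 : 0 ≤ Real.log (3 / 2) := Real.log_nonneg (by norm_num)
      rw [e]
      push_cast
      nlinarith
    · push Not at h
      refine le_add_of_nonneg_of_le (by positivity) (hpow 3 _ ?_)
      have hl := Real.log_two_gt_d9
      push_cast
      nlinarith
  refine hterm.trans (Finset.single_le_sum (f := fun i =>
    ε ^ 2 * poissonTilt p (Pi.single i (Real.log (2 / 3))) x +
      ε ^ 3 * poissonTilt p (Pi.single i (Real.log 2)) x) (fun j _ => ?_) (Finset.mem_univ i))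
  unfold poissonTilt
  positivity

lemma sum_countTo {n K : ℕ} (x : Fin n → Fin K) : ∑ i, (countTo x n i : ℝ) = n := by
  simpa using sum_mul_countTo (fun _ => 1) x

/-- guarantees for the maximum likelihood estimator when all categories
satisfy `n·p*(i) ≥ 32·log(K/δ)` (i.e. `|𝒥̃| = 0`). -/
theorem mle_guarantees :
    ∃ C : ℝ, 0 < C ∧
      ∀ (K n : ℕ), 2 ≤ K → 1 ≤ n → ∀ δ : ℝ, δ ∈ Set.Ioo (0 : ℝ) 1 →
      ∀ pstar : Fin K → ℝ, pstar ∈ simplex K →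
      (∀ i, 32 * Real.log (K / δ) ≤ (n : ℝ) * pstar i) →
      (1 - ENNReal.ofReal δ ≤
        iidMeasure n K pstar
          {x | klD pstar (fun i => (countTo x n i : ℝ) / n) ≤
            ENNReal.ofReal (C * ((K : ℝ) + Real.log (1 / δ)) / n)}) ∧
      (1 - ENNReal.ofReal δ ≤
        iidMeasure n K pstar
          {x |
            let pb : Fin K → ℝ := fun i => (countTo x n i : ℝ) / n;
            (∀ i, 0 < pb i) ∧
            (1/6 : ℝ) * chiSq pstar pb ≤ (1/4) * chiSq pb pstar ∧
            (1/4 : ℝ) * chiSq pb pstar ≤ klReal pstar pb ∧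
            klReal pstar pb ≤ (5/2) * hellSq pstar pb ∧
            (5/2 : ℝ) * hellSq pstar pb ≤ (5/2) * klReal pb pstar ∧
            (5/2 : ℝ) * klReal pb pstar ≤ (5/2) * chiSq pb pstar ∧
            (5/2 : ℝ) * chiSq pb pstar ≤ 5 * chiSq pstar pb}) := by
  set A : ℝ := ∑' j : ℤ, Real.exp (-|(j : ℝ)|) with hA
  have hA1 : 1 ≤ A := by
    simpa using summable_exp_neg_abs_int.le_tsum (0 : ℤ) fun j _ => (Real.exp_pos _).le
  have hlA : 0 ≤ Real.log A := Real.log_nonneg hA1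
  refine ⟨40 * (2 + Real.log A), by positivity, ?_⟩
  rintro K n hK hn δ ⟨hδ0, hδ1⟩ p hp hlog
  have hK2 : (2 : ℝ) ≤ K := by exact_mod_cast hK
  have hn0 : (0 : ℝ) < n := by exact_mod_cast hn
  set ε : ℝ := δ / K with hε
  have hε0 : 0 < ε := by positivity
  have hε2 : ε ≤ 1 / 2 := by
    rw [hε, div_le_iff₀ (by positivity)]
    linarith
  have hKε : K * ε = δ := by
    rw [hε]
    field_simp
  have hlog' : ∀ i, 32 * Real.log ε⁻¹ ≤ n * p i := by
    intro i
    rw [hε, inv_div]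
    exact hlog i
  have hm : ∀ i, 0 < n * p i := fun i => lt_of_lt_of_le (by
    have : 0 < Real.log ε⁻¹ := Real.log_pos ((one_lt_inv₀ hε0).2 (by linarith))
    positivity) (hlog' i)
  have hp0 : ∀ i, 0 < p i := fun i => pos_of_mul_pos_right (hm i) hn0.le
  have hpen : iidExp (n := n) p (ratioPenalty p ε) ≤ 3 / 4 * δ := by
    refine (iidExp_ratioPenalty_le hp hε0.le).trans ?_
    calc K * (ε ^ 2 + ε ^ 3) = δ * (ε + ε ^ 2) := by rw [← hKε]; ring
      _ ≤ δ * (3 / 4) := mul_le_mul_of_nonneg_left (by nlinarith) hδ0.le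
      _ = 3 / 4 * δ := mul_comm _ _
  have hchain : ∀ x : Fin n → Fin K, ratioPenalty p ε x < 1 →
      (∀ i, 2 / 3 * (n * p i) ≤ countTo x n i ∧ (countTo x n i : ℝ) ≤ 2 * (n * p i)) := by
    intro x hx i
    by_contra h
    exact absurd (one_le_ratioPenalty hε0 (by linarith) hlog' h) (not_le.2 hx)
  have hdiv : ∀ x : Fin n → Fin K, ratioPenalty p ε x < 1 →
      let q : Fin K → ℝ := fun i => (countTo x n i : ℝ) / n
      (∀ i, 0 < q i) ∧ (1 / 6 : ℝ) * chiSq p q ≤ (1 / 4) * chiSq q p ∧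
      (1 / 4 : ℝ) * chiSq q p ≤ klReal p q ∧ klReal p q ≤ (5 / 2) * hellSq p q ∧
      hellSq p q ≤ klReal q p ∧ klReal q p ≤ chiSq q p ∧ chiSq q p ≤ 2 * chiSq p q := by
    intro x hx q
    have h := hchain x hx
    have hlo : ∀ i, 2 / 3 * p i ≤ q i := fun i => by
      rw [le_div_iff₀ hn0]
      linarith [(h i).1]
    have hhi : ∀ i, q i ≤ 2 * p i := fun i => by
      rw [div_le_iff₀ hn0]
      linarith [(h i).2]
    refine ⟨fun i => by linarith [hlo i, hp0 i], divergence_chain ?_ hp0 hlo hhi⟩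
    rw [← Finset.sum_div, sum_countTo, div_self hn0.ne', hp.2]
  constructor
  · refine one_sub_le_iidMeasure hp
      (B := fun x => ratioPenalty p ε x +
        δ / (4 * A ^ K) * tiltMixture p (Finset.Icc (-n) n) x) (fun x => ?_) (fun x hx => ?_) ?_
    · have h1 := ratioPenalty_nonneg p hε0.le x
      have h2 := tiltMixture_nonneg p (Finset.Icc (-n) n) x
      positivity
    · by_contra! hlt
      have hmix := tiltMixture_nonneg p (Finset.Icc (-n) n) x
      have hc0 : 0 < δ / (4 * A ^ K) := by positivity
      have hpen1 : ratioPenalty p ε x < 1 := by nlinarith [mul_nonneg hc0.le hmix]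
      obtain ⟨hq, -, -, h1, h2, h3, -⟩ := hdiv x hpen1
      refine hx ?_
      rw [Set.mem_ofPred_eq, klD, if_pos fun i _ => hq i]
      refine ENNReal.ofReal_le_ofReal ?_
      set Z := ∑ i, (countTo x n i - n * p i) ^ 2 / (16 * (n * p i)) with hZ
      have hchi : chiSq (fun i => (countTo x n i : ℝ) / n) p = 16 * Z / n := by
        rw [chiSq, hZ, Finset.mul_sum, Finset.sum_div]
        refine Finset.sum_congr rfl fun i _ => ?_
        have := hp0 i
        field_simp
      have hexp := exp_le_tiltMixture hp hm fun i => (hchain x hpen1 i).2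
      have hlt' : δ / (4 * A ^ K) * Real.exp (Z - K) < 1 :=
        lt_of_le_of_lt (mul_le_mul_of_nonneg_left hexp hc0.le)
          (by linarith [ratioPenalty_nonneg p hε0.le x])
      have hZle : Z ≤ K + (Real.log 4 + K * Real.log A + Real.log (1 / δ)) := by
        have h4 : Real.exp (Z - K) < 4 * A ^ K * (1 / δ) := by
          rw [div_mul_eq_mul_div, div_lt_one (by positivity)] at hlt'
          rw [mul_one_div, lt_div_iff₀ hδ0]
          linarith
        have h5 := (Real.lt_log_iff_exp_lt (by positivity)).2 h4
        rw [Real.log_mul (by positivity) (by positivity), Real.log_mul (by norm_num)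
          (by positivity), Real.log_pow] at h5
        linarith
      have hlog4 : Real.log 4 ≤ K := by
        have : Real.log 4 = 2 * Real.log 2 := by
          rw [show (4 : ℝ) = 2 ^ 2 by norm_num, Real.log_pow]
          norm_num
        linarith [Real.log_two_lt_d9]
      have hlδ : 0 ≤ Real.log (1 / δ) := Real.log_nonneg ((one_le_div hδ0).2 hδ1.le)
      have hkl : klReal p (fun i => (countTo x n i : ℝ) / n) ≤ 40 * Z / n := by
        calc _ ≤ 5 / 2 * (16 * Z / n) := by linarith
          _ = 40 * Z / n := by ring
      refine hkl.trans (div_le_div_of_nonneg_right ?_ hn0.le)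
      nlinarith [mul_nonneg hlA hlδ]
    · rw [iidExp_add, iidExp_const_mul]
      have hT : ∑ j ∈ Finset.Icc (-(n : ℤ)) n, Real.exp (-|(j : ℝ)|) ≤ A :=
        summable_exp_neg_abs_int.sum_le_tsum _ fun j _ => (Real.exp_pos _).le
      have h1 : iidExp (n := n) p (tiltMixture p (Finset.Icc (-n) n)) ≤ A ^ K :=
        (iidExp_tiltMixture_le hp _).trans
          (pow_le_pow_left₀ (Finset.sum_nonneg fun _ _ => (Real.exp_pos _).le) hT K)
      have h2 := mul_le_mul_of_nonneg_left h1 (by positivity : 0 ≤ δ / (4 * A ^ K))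
      have h3 : δ / (4 * A ^ K) * A ^ K = δ / 4 := by
        have : 0 < A ^ K := by positivity
        field_simp
      linarith
  · refine one_sub_le_iidMeasure hp (B := ratioPenalty p ε)
      (ratioPenalty_nonneg p hε0.le) (fun x hx => ?_) (by linarith)
    by_contra! hlt
    obtain ⟨h0, h1, h2, h3, h4, h5, h6⟩ := hdiv x hlt
    exact hx ⟨h0, h1, h2, h3, by linarith, by linarith, by linarith⟩
end
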